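/- arXiv:1708.07707 — 2 statements merged into one kernel-verified Lean document; each statement's English description precedes it below -/
import Mathlib

section
/- The linear span of the functions F_{m,n}(x,y) = x^{n-m} y^m e^{-(x²+y²)/2}, for 0 ≤ m ≤ n, is dense in the Schwartz space S(ℝ²). -/
namespace MGD

open MeasureTheory SchwartzMap
open scoped LineDeriv

abbrev S2 := SchwartzMap (ℝ × ℝ) ℝ

/-- the monomial-gaussian functions -/
noncomputable def gf (a b : ℕ) (p : ℝ × ℝ) : ℝ :=
  p.1 ^ a * p.2 ^ b * Real.exp (-(p.1 ^ 2 + p.2 ^ 2) / 2)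

lemma gf_contDiff (a b : ℕ) (n : WithTop ℕ∞) : ContDiff ℝ n (gf a b) := by
  unfold gf
  fun_prop

lemma gf_fderiv (a b : ℕ) : fderiv ℝ (gf a b) = fun p =>
    ((a : ℝ) • (gf (a - 1) b p • ContinuousLinearMap.fst ℝ ℝ ℝ)
      - gf (a + 1) b p • ContinuousLinearMap.fst ℝ ℝ ℝ)
    + ((b : ℝ) • (gf a (b - 1) p • ContinuousLinearMap.snd ℝ ℝ ℝ)
      - gf a (b + 1) p • ContinuousLinearMap.snd ℝ ℝ ℝ) := by
  funext p
  have h1 : HasFDerivAt (fun p : ℝ × ℝ => p.1) (ContinuousLinearMap.fst ℝ ℝ ℝ) p := hasFDerivAt_fst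
  have h2 : HasFDerivAt (fun p : ℝ × ℝ => p.2) (ContinuousLinearMap.snd ℝ ℝ ℝ) p := hasFDerivAt_snd
  have h := (((h1.pow a).mul (h2.pow b)).mul
    ((((h1.pow 2).add (h2.pow 2)).neg.mul_const (1/2)).exp))
  have h' : HasFDerivAt (gf a b) _ p := h.congr_of_eventuallyEq (by
    refine Filter.Eventually.of_forall fun q => ?_
    simp [gf]; left; ring_nf)
  rw [h'.fderiv]
  ext <;> simp [gf] <;> ring_nf

lemma gf_bound0 (k : ℕ) : ∃ C : ℝ, ∀ t : ℝ, 0 ≤ t → t ^ k * Real.exp (-t ^ 2 / 2) ≤ C := by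
  refine ⟨(2 ^ k * k.factorial : ℝ) * Real.exp 1, fun t ht => ?_⟩
  have h1 : (t / 2) ^ k / k.factorial ≤ Real.exp (t / 2) := Real.pow_div_factorial_le_exp _ (by positivity) _
  have h2 : t ^ k ≤ 2 ^ k * k.factorial * Real.exp (t / 2) := by
    rw [div_le_iff₀ (by positivity), div_pow, div_le_iff₀ (by positivity)] at h1
    linarith
  calc t ^ k * Real.exp (-t ^ 2 / 2) ≤ (2 ^ k * k.factorial * Real.exp (t / 2)) * Real.exp (-t ^ 2 / 2) := by gcongr
    _ = 2 ^ k * k.factorial * Real.exp (t / 2 + -t ^ 2 / 2) := by rw [Real.exp_add]; ring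
    _ ≤ _ := by
      gcongr
      nlinarith [sq_nonneg (t - 1/2)]

lemma gf_decay (n : ℕ) : ∀ (a b k : ℕ), ∃ C : ℝ, ∀ p,
    ‖p‖ ^ k * ‖iteratedFDeriv ℝ n (gf a b) p‖ ≤ C := by
  induction n with
  | zero =>
    intro a b k
    obtain ⟨C, hC⟩ := gf_bound0 (k + a + b)
    refine ⟨C, fun p => le_trans ?_ (hC ‖p‖ (norm_nonneg _))⟩
    rw [norm_iteratedFDeriv_zero, gf, norm_mul, norm_mul, norm_pow, norm_pow, pow_add, pow_add,
      mul_assoc, mul_assoc, Real.norm_eq_abs (Real.exp _), Real.abs_exp, mul_assoc]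
    have h1 := norm_fst_le p
    have h2 := norm_snd_le p
    have h3 : ‖p‖ ^ 2 ≤ p.1 ^ 2 + p.2 ^ 2 := by
      rw [Prod.norm_def]
      rcases max_cases ‖p.1‖ ‖p.2‖ with h | h <;> rw [h.1, Real.norm_eq_abs, sq_abs] <;> nlinarith [sq_nonneg p.1, sq_nonneg p.2]
    gcongr
  | succ n ih =>
    intro a b k
    obtain ⟨C1, h1⟩ := ih (a - 1) b k
    obtain ⟨C2, h2⟩ := ih (a + 1) b k
    obtain ⟨C3, h3⟩ := ih a (b - 1) k
    obtain ⟨C4, h4⟩ := ih a (b + 1) k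
    refine ⟨(a * C1 + C2) + (b * C3 + C4), fun p => ?_⟩
    have key : ∀ (c d : ℕ) (L : ℝ × ℝ →L[ℝ] ℝ), ‖L‖ ≤ 1 →
        ‖iteratedFDeriv ℝ n (fun p => gf c d p • L) p‖ ≤ ‖iteratedFDeriv ℝ n (gf c d) p‖ := by
      intro c d L hL
      have := ContinuousLinearMap.norm_iteratedFDeriv_comp_left
        (ContinuousLinearMap.toSpanSingleton ℝ L) (f := gf c d) (x := p) (n := n)
        (gf_contDiff c d n).contDiffAt le_rfl
      refine this.trans ?_
      rw [ContinuousLinearMap.norm_toSpanSingleton]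
      exact mul_le_of_le_one_left (norm_nonneg _) hL
    have hc : ∀ (c d : ℕ) (L : ℝ × ℝ →L[ℝ] ℝ), ContDiffAt ℝ n (fun p => gf c d p • L) p := by
      intro c d L
      exact ((gf_contDiff c d n).smul contDiff_const).contDiffAt
    have e1 := key (a - 1) b _ (ContinuousLinearMap.norm_fst_le ℝ ℝ ℝ)
    have e2 := key (a + 1) b _ (ContinuousLinearMap.norm_fst_le ℝ ℝ ℝ)
    have e3 := key a (b - 1) _ (ContinuousLinearMap.norm_snd_le ℝ ℝ ℝ)
    have e4 := key a (b + 1) _ (ContinuousLinearMap.norm_snd_le ℝ ℝ ℝ)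
    have c1 := hc (a - 1) b (ContinuousLinearMap.fst ℝ ℝ ℝ)
    have c2 := hc (a + 1) b (ContinuousLinearMap.fst ℝ ℝ ℝ)
    have c3 := hc a (b - 1) (ContinuousLinearMap.snd ℝ ℝ ℝ)
    have c4 := hc a (b + 1) (ContinuousLinearMap.snd ℝ ℝ ℝ)
    rw [← norm_iteratedFDeriv_fderiv, gf_fderiv]
    have s1 : ContDiffAt ℝ n (fun p => (a : ℝ) • gf (a - 1) b p • ContinuousLinearMap.fst ℝ ℝ ℝ) p := contDiffAt_const (𝕜 := ℝ) (c := (a : ℝ)) (n := n) (x := p) |>.smul c1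
    have s3 : ContDiffAt ℝ n (fun p => (b : ℝ) • gf a (b - 1) p • ContinuousLinearMap.snd ℝ ℝ ℝ) p := contDiffAt_const (𝕜 := ℝ) (c := (b : ℝ)) (n := n) (x := p) |>.smul c3
    rw [fun_iteratedFDeriv_add_apply (s1.sub c2) (s3.sub c4), fun_iteratedFDeriv_sub_apply s1 c2,
      fun_iteratedFDeriv_sub_apply s3 c4, iteratedFDeriv_const_smul_apply' c1,
      iteratedFDeriv_const_smul_apply' c3]
    have t : ‖p‖ ^ k * (((a : ℝ) * ‖iteratedFDeriv ℝ n (gf (a - 1) b) p‖ + ‖iteratedFDeriv ℝ n (gf (a + 1) b) p‖)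
      + ((b : ℝ) * ‖iteratedFDeriv ℝ n (gf a (b - 1)) p‖ + ‖iteratedFDeriv ℝ n (gf a (b + 1)) p‖)) ≤
       (a * C1 + C2) + (b * C3 + C4) := by
      have := mul_le_mul_of_nonneg_left (h1 p) (Nat.cast_nonneg (α := ℝ) a)
      have := mul_le_mul_of_nonneg_left (h3 p) (Nat.cast_nonneg (α := ℝ) b)
      linarith [h2 p, h4 p]
    refine le_trans ?_ t
    gcongr
    refine (norm_add_le _ _).trans (add_le_add ((norm_sub_le _ _).trans (add_le_add ?_ e2))
      ((norm_sub_le _ _).trans (add_le_add ?_ e4)))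
    · rw [norm_smul, Real.norm_natCast]; gcongr
    · rw [norm_smul, Real.norm_natCast]; gcongr

noncomputable def gS (a b : ℕ) : S2 where
  toFun := gf a b
  smooth' := gf_contDiff a b _
  decay' k n := gf_decay n a b k

@[simp] lemma gS_apply (a b : ℕ) (p : ℝ × ℝ) : gS a b p = gf a b p := rfl

noncomputable def cf (i : Bool) : ℝ × ℝ →L[ℝ] ℝ :=
  if i then ContinuousLinearMap.fst ℝ ℝ ℝ else ContinuousLinearMap.snd ℝ ℝ ℝ

def ev (i : Bool) : ℝ × ℝ := if i then (1, 0) else (0, 1)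

lemma cf_ev (i j : Bool) : cf i (ev j) = if i = j then 1 else 0 := by
  cases i <;> cases j <;> simp [cf, ev]

noncomputable def Mo (i : Bool) : S2 →L[ℝ] S2 := smulLeftCLM ℝ (fun p => cf i p)

noncomputable def Do (i : Bool) : S2 →L[ℝ] S2 := LineDeriv.lineDerivOpCLM ℝ S2 (ev i)

@[simp] lemma Mo_apply (i : Bool) (f : S2) (p : ℝ × ℝ) : Mo i f p = cf i p * f p := by
  rw [Mo, smulLeftCLM_apply_apply (cf i).hasTemperateGrowth, smul_eq_mul]

lemma Do_apply (i : Bool) (f : S2) (p : ℝ × ℝ) : Do i f p = fderiv ℝ f p (ev i) := rfl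

lemma Do_Mo (i j : Bool) (f : S2) :
    Do i (Mo j f) = Mo j (Do i f) + (if j = i then (1 : ℝ) else 0) • f := by
  ext p
  have h : HasFDerivAt (Mo j f) _ p :=
    (((cf j).hasFDerivAt (x := p)).mul (f.hasFDerivAt p)).congr_of_eventuallyEq
      (Filter.Eventually.of_forall fun q => by simp)
  rw [Do_apply, h.fderiv]
  simp [cf_ev, Do_apply]
  split_ifs <;> simp

lemma Do_comm (i j : Bool) (f : S2) : Do i (Do j f) = Do j (Do i f) := by
  ext p
  have hd : ∀ k : Bool, ∀ v, fderiv ℝ (Do k f) p v = fderiv ℝ (fderiv ℝ f) p v (ev k) := by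
    intro k v
    have h : HasFDerivAt (fderiv ℝ f) (fderiv ℝ (fderiv ℝ f) p) p :=
      (fderivCLM ℝ (ℝ × ℝ) ℝ f).hasFDerivAt p
    have := (h.clm_apply (hasFDerivAt_const (ev k) p))
    have h' : HasFDerivAt (Do k f) _ p := this
    rw [h'.fderiv]
    simp
  rw [Do_apply, Do_apply, hd, hd]
  exact second_derivative_symmetric (f := f) (f' := fderiv ℝ f) (fun x => f.hasFDerivAt x)
    ((fderivCLM ℝ (ℝ × ℝ) ℝ f).hasFDerivAt p) _ _

lemma Mo_comm (i j : Bool) (f : S2) : Mo i (Mo j f) = Mo j (Mo i f) := by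
  ext p; simp; ring

noncomputable def Ho : S2 →L[ℝ] S2 :=
  ((Mo true).comp (Mo true) - (Do true).comp (Do true)) +
    ((Mo false).comp (Mo false) - (Do false).comp (Do false))

lemma Ho_apply (f : S2) : Ho f = (Mo true (Mo true f) - Do true (Do true f)) +
    (Mo false (Mo false f) - Do false (Do false f)) := rfl

noncomputable def Xo (s : Bool × Bool) : S2 →L[ℝ] S2 := if s.1 then Mo s.2 else Do s.2

lemma Ho_Xo (s : Bool × Bool) (f : S2) : Ho (Xo s f) = Xo s (Ho f) - (2 : ℝ) • Xo (!s.1, s.2) f := by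
  obtain ⟨u, i⟩ := s
  cases u <;> cases i <;>
    simp only [Xo, Ho_apply, Bool.not_true, Bool.not_false, if_true, Bool.false_eq_true, if_false, map_add, map_sub, Do_Mo,
      Do_comm false true, Mo_comm false true, zero_smul, add_zero, one_smul, Bool.true_eq_false, two_smul] <;> abel

noncomputable def ip (f g : S2) : ℝ := ∫ p, f p * g p

noncomputable def nn (f : S2) : ℝ := ‖f.toLp 2 volume‖

lemma ip_eq (f g : S2) : ip f g = inner ℝ (f.toLp 2 volume) (g.toLp 2 volume) := by
  rw [ip, L2.inner_def]
  apply integral_congr_ae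
  filter_upwards [f.coeFn_toLp 2 volume, g.coeFn_toLp 2 volume] with x hf hg
  rw [hf, hg]; simp [mul_comm]

lemma nn_nonneg (f : S2) : 0 ≤ nn f := norm_nonneg _

lemma ip_self (f : S2) : ip f f = nn f ^ 2 := by
  rw [ip_eq, nn, real_inner_self_eq_norm_sq]

lemma ip_le (f g : S2) : ip f g ≤ nn f * nn g := by
  rw [ip_eq]; exact real_inner_le_norm _ _

lemma toLp_add (f g : S2) : (f + g).toLp 2 volume = f.toLp 2 volume + g.toLp 2 volume := rfl
lemma toLp_sub (f g : S2) : (f - g).toLp 2 volume = f.toLp 2 volume - g.toLp 2 volume := rfl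
lemma toLp_smul (c : ℝ) (f : S2) : (c • f).toLp 2 volume = c • f.toLp 2 volume := rfl

lemma nn_add (f g : S2) : nn (f + g) ≤ nn f + nn g := by
  simp only [nn, toLp_add]; exact norm_add_le _ _
lemma nn_sub (f g : S2) : nn (f - g) ≤ nn f + nn g := by
  simp only [nn, toLp_sub]; exact norm_sub_le _ _
lemma nn_smul (c : ℝ) (f : S2) : nn (c • f) = |c| * nn f := by
  simp only [nn, toLp_smul, norm_smul, Real.norm_eq_abs]

lemma ip_add_left (f g h : S2) : ip (f + g) h = ip f h + ip g h := by
  simp only [ip_eq, toLp_add, inner_add_left]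
lemma ip_sub_left (f g h : S2) : ip (f - g) h = ip f h - ip g h := by
  simp only [ip_eq, toLp_sub, inner_sub_left]
lemma ip_comm (f g : S2) : ip f g = ip g f := by
  simp only [ip, mul_comm]

lemma ip_Mo (i : Bool) (f g : S2) : ip (Mo i f) g = ip f (Mo i g) := by
  simp only [ip, Mo_apply]; congr 1; ext p; ring

lemma ip_Do (i : Bool) (f g : S2) : ip (Do i f) g = - ip f (Do i g) := by
  have := integral_mul_lineDerivOp_right_eq_neg_left (μ := volume) f g (ev i)
  change ip f (Do i g) = - ip (Do i f) g at this
  rw [this, neg_neg]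

lemma ip_Ho (f : S2) : ip (Ho f) f = (nn (Mo true f) ^ 2 + nn (Do true f) ^ 2) +
    (nn (Mo false f) ^ 2 + nn (Do false f) ^ 2) := by
  rw [Ho_apply]
  simp only [ip_add_left, ip_sub_left, ip_Mo _ (Mo _ _), ip_Do _ (Do _ _), ← ip_self]
  ring

lemma nn_sq_le (f : S2) : nn f ^ 2 ≤ nn (Mo true f) ^ 2 + nn (Do true f) ^ 2 := by
  have h := Do_Mo true true f
  simp only [if_true, one_smul] at h
  have h2 : ip (Do true (Mo true f)) f = ip (Mo true (Do true f)) f + ip f f := by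
    conv_lhs => rw [h]
    rw [ip_add_left]
  rw [ip_Do, ip_self, ip_Mo true (Do true f) f, ip_comm (Do true f)] at h2
  have h3 := ip_le (Mo true f) (-Do true f)
  have h4 : ip (Mo true f) (- Do true f) = - ip (Mo true f) (Do true f) := by
    simp [ip, integral_neg]
  have h5 : nn (-Do true f) = nn (Do true f) := by
    have := nn_smul (-1) (Do true f); simpa using this
  rw [h4, h5] at h3
  nlinarith [sq_nonneg (nn (Mo true f) - nn (Do true f))]

lemma nn_le_Ho (f : S2) : nn f ≤ nn (Ho f) := by
  have h1 := nn_sq_le f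
  have h2 := ip_Ho f
  have h3 := ip_le (Ho f) f
  by_contra! h
  nlinarith [nn_nonneg f, nn_nonneg (Ho f), sq_nonneg (nn (Mo false f)), sq_nonneg (nn (Do false f))]

lemma nn_Xo_le (s : Bool × Bool) (f : S2) : nn (Xo s f) ≤ nn (Ho f) := by
  have h2 := ip_Ho f
  have h3 := ip_le (Ho f) f
  have h4 := nn_le_Ho f
  have h5 : nn (Xo s f) ^ 2 ≤ ip (Ho f) f := by
    rw [h2]
    obtain ⟨u, i⟩ := s
    cases u <;> cases i <;> simp only [Xo, if_true, Bool.false_eq_true, if_false] <;> nlinarith [sq_nonneg (nn (Mo false f)), sq_nonneg (nn (Do false f)), sq_nonneg (nn (Mo true f)), sq_nonneg (nn (Do true f))]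
  refine abs_le_of_sq_le_sq' ?_ (nn_nonneg _) |>.2
  nlinarith [nn_nonneg f, nn_nonneg (Ho f)]

lemma nn_Ho_pow_Xo (n : ℕ) : ∀ (s : Bool × Bool) (f : S2),
    nn (Ho^[n] (Xo s f)) ≤ 3 ^ n * nn (Ho^[n + 1] f) := by
  induction n with
  | zero => intro s f; simpa using nn_Xo_le s f
  | succ n ih =>
    intro s f
    have hlin : ∀ (a b : S2), Ho^[n] (a - (2 : ℝ) • b) = Ho^[n] a - (2 : ℝ) • Ho^[n] b := by
      intro a b
      rw [← FunLike.coe_pow_eq_iterate, map_sub, map_smul]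
    rw [Function.iterate_succ_apply, Ho_Xo, hlin]
    refine (nn_sub _ _).trans ?_
    rw [nn_smul]
    have h1 := ih s (Ho f)
    have h2 := ih (!s.1, s.2) f
    have h3 := nn_le_Ho (Ho^[n + 1] f)
    rw [← Function.iterate_succ_apply] at h1
    rw [← Function.iterate_succ_apply' Ho] at h3
    have h4 := mul_le_mul_of_nonneg_left h3 (by positivity : (0:ℝ) ≤ 3 ^ n)
    rw [abs_of_pos two_pos, pow_succ]
    linarith

lemma nn_Ho_mono {m n : ℕ} (h : m ≤ n) (f : S2) : nn (Ho^[m] f) ≤ nn (Ho^[n] f) := by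
  induction n, h using Nat.le_induction with
  | base => exact le_rfl
  | succ n _ ih => rw [Function.iterate_succ_apply']; exact ih.trans (nn_le_Ho _)

/-- the monomial-gaussian span -/
noncomputable def Wo : Submodule ℝ S2 := Submodule.span ℝ (Set.range fun q : ℕ × ℕ => gS q.1 q.2)

lemma Mo_true_gS (a b : ℕ) : Mo true (gS a b) = gS (a + 1) b := by
  ext p; simp [gf, cf]; ring
lemma Mo_false_gS (a b : ℕ) : Mo false (gS a b) = gS a (b + 1) := by
  ext p; simp [gf, cf]; ring
lemma Do_true_gS (a b : ℕ) : Do true (gS a b) = (a : ℝ) • gS (a - 1) b - gS (a + 1) b := by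
  ext p
  rw [Do_apply, show (gS a b : ℝ × ℝ → ℝ) = gf a b from rfl, gf_fderiv]; simp [ev]
lemma Do_false_gS (a b : ℕ) : Do false (gS a b) = (b : ℝ) • gS a (b - 1) - gS a (b + 1) := by
  ext p
  rw [Do_apply, show (gS a b : ℝ × ℝ → ℝ) = gf a b from rfl, gf_fderiv]; simp [ev]

lemma Ho_gS (a b : ℕ) : Ho (gS a b) = (2 * (a + b + 1) : ℝ) • gS a b
    - ((a * (a - 1 : ℕ) : ℝ) • gS (a - 2) b + (b * (b - 1 : ℕ) : ℝ) • gS a (b - 2)) := by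
  have e1 : ∀ n : ℕ, (n : ℝ) • gS (n - 1 + 1) b = (n : ℝ) • gS n b := by
    intro n; cases n <;> simp
  have e2 : ∀ n : ℕ, (n : ℝ) • gS a (n - 1 + 1) = (n : ℝ) • gS a n := by
    intro n; cases n <;> simp
  simp only [Ho_apply, Mo_true_gS, Mo_false_gS, Do_true_gS, Do_false_gS, map_sub, map_smul, smul_sub, e1, e2, Nat.add_sub_cancel, smul_smul, Nat.sub_sub]
  push_cast
  module

lemma gS_mem (n : ℕ) : ∀ a b : ℕ, a + b = n → gS a b ∈ Wo.map (Ho : S2 →ₗ[ℝ] S2) := by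
  induction n using Nat.strong_induction_on with
  | _ n ih =>
    intro a b hab
    have h1 : (a * (a - 1 : ℕ) : ℝ) • gS (a - 2) b ∈ Wo.map (Ho : S2 →ₗ[ℝ] S2) := by
      rcases lt_or_ge a 2 with h | h
      · interval_cases a <;> simp
      · exact Submodule.smul_mem _ _ (ih _ (by omega) (a - 2) b rfl)
    have h2 : (b * (b - 1 : ℕ) : ℝ) • gS a (b - 2) ∈ Wo.map (Ho : S2 →ₗ[ℝ] S2) := by
      rcases lt_or_ge b 2 with h | h
      · interval_cases b <;> simp
      · exact Submodule.smul_mem _ _ (ih _ (by omega) a (b - 2) rfl)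
    have h3 : Ho (gS a b) ∈ Wo.map (Ho : S2 →ₗ[ℝ] S2) :=
      Submodule.mem_map_of_mem (f := (Ho : S2 →ₗ[ℝ] S2)) (Submodule.subset_span ⟨(a, b), rfl⟩)
    have h4 := Submodule.smul_mem _ ((2 * (a + b + 1) : ℝ)⁻¹) (Submodule.add_mem _ h3 (Submodule.add_mem _ h1 h2))
    rw [Ho_gS, sub_add_cancel, smul_smul, inv_mul_cancel₀ (by positivity), one_smul] at h4
    exact h4

lemma Wo_surj (w : S2) (hw : w ∈ Wo) : ∃ v ∈ Wo, Ho v = w := by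
  have : Wo ≤ Wo.map (Ho : S2 →ₗ[ℝ] S2) := by
    conv_lhs => rw [Wo]
    rw [Submodule.span_le]
    rintro _ ⟨⟨a, b⟩, rfl⟩
    exact gS_mem _ a b rfl
  exact this hw

lemma Wo_surj_pow (n : ℕ) : ∀ (w : S2), w ∈ Wo → ∃ v ∈ Wo, Ho^[n] v = w := by
  induction n with
  | zero => intro w hw; exact ⟨w, hw, rfl⟩
  | succ n ih =>
    intro w hw
    obtain ⟨v, hv, rfl⟩ := ih w hw
    obtain ⟨u, hu, rfl⟩ := Wo_surj v hv
    exact ⟨u, hu, rfl⟩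

lemma one_dim_bound (h : SchwartzMap ℝ ℝ) (x : ℝ) : |h x| ≤ ∫ s, |deriv h s| := by
  have hint : Integrable (deriv h) := (derivCLM ℝ ℝ h).integrable
  have h0 : Filter.Tendsto h Filter.atBot (nhds 0) :=
    h.tendsto_cocompact.mono_left (by rw [cocompact_eq_atBot_atTop]; exact le_sup_left)
  have := integral_Iic_of_hasDerivAt_of_tendsto (a := x) (f := h) (f' := deriv h)
    h.continuous.continuousAt.continuousWithinAt (fun y _ => h.hasDerivAt y) hint.integrableOn h0
  rw [sub_zero] at this
  rw [← this, ← Real.norm_eq_abs]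
  refine (norm_integral_le_integral_norm _).trans ?_
  exact setIntegral_le_integral hint.norm (Filter.Eventually.of_forall fun _ => norm_nonneg _)

noncomputable def slice (i : Bool) (q : ℝ × ℝ) (f : S2) : SchwartzMap ℝ ℝ :=
  compCLM ℝ (g := fun s : ℝ => s • ev i + q)
    (((ContinuousLinearMap.toSpanSingleton ℝ (ev i)).hasTemperateGrowth).add
      (Function.HasTemperateGrowth.const q))
    ⟨1, 1 + ‖q‖, fun x => by
      have h1 : ‖x‖ = ‖x • ev i‖ := by
        rw [norm_smul]; cases i <;> simp [ev, Prod.norm_def]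
      have h2 : ‖x • ev i‖ ≤ ‖x • ev i + q‖ + ‖q‖ := by
        simpa using norm_sub_le (x • ev i + q) q
      rw [h1]
      nlinarith [norm_nonneg q, norm_nonneg (x • ev i + q)]⟩ f

lemma slice_apply (i : Bool) (q : ℝ × ℝ) (f : S2) (s : ℝ) : slice i q f s = f (s • ev i + q) := rfl

lemma slice_deriv (i : Bool) (q : ℝ × ℝ) (f : S2) (s : ℝ) :
    deriv (slice i q f) s = Do i f (s • ev i + q) := by
  have h1 : HasDerivAt (fun s : ℝ => s • ev i + q) (ev i) s := by
    simpa using ((hasDerivAt_id s).smul_const (ev i)).add_const q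
  have := (f.hasFDerivAt (s • ev i + q)).comp_hasDerivAt s h1
  exact this.deriv

lemma sup_bound (f : S2) (p : ℝ × ℝ) : |f p| ≤ ∫ q, |Do false (Do true f) q| := by
  set v := Do false (Do true f) with hv
  have hvi : Integrable (fun q => |v q|) := v.integrable.norm
  have h1 := one_dim_bound (slice true (0, p.2) f) p.1
  simp only [slice_deriv, slice_apply] at h1
  have h2 : ∀ s : ℝ, |Do true f (s, p.2)| ≤ ∫ t, |v (s, t)| := by
    intro s
    have h1 := one_dim_bound (slice false (s, 0) (Do true f)) p.2
    simp only [slice_deriv, slice_apply] at h1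
    simpa [ev] using h1
  have h3 : |f p| ≤ ∫ s, |Do true f (s, p.2)| := by simpa [ev] using h1
  refine h3.trans ?_
  rw [show (volume : Measure (ℝ × ℝ)) = (volume : Measure ℝ).prod volume from rfl] at hvi ⊢
  rw [integral_prod _ hvi]
  refine integral_mono ?_ hvi.integral_prod_left h2
  have := (slice true (0, p.2) (Do true f)).integrable (μ := volume) |>.norm
  simpa [slice_apply, ev] using this

noncomputable def rho (p : ℝ × ℝ) : ℝ := (1 + p.1 ^ 2)⁻¹ * (1 + p.2 ^ 2)⁻¹

lemma rho_memLp : MemLp rho 2 (volume : Measure (ℝ × ℝ)) := by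
  have hc : Continuous rho := by
    unfold rho
    exact (Continuous.inv₀ (by fun_prop) (fun p => by positivity)).mul
      (Continuous.inv₀ (by fun_prop) (fun p => by positivity))
  rw [memLp_two_iff_integrable_sq hc.aestronglyMeasurable]
  have h : Integrable rho (volume : Measure (ℝ × ℝ)) :=
    Integrable.mul_prod integrable_inv_one_add_sq integrable_inv_one_add_sq
  refine h.mono' (hc.pow 2).aestronglyMeasurable (Filter.Eventually.of_forall fun p => ?_)
  have h0 : 0 ≤ rho p := by unfold rho; positivity
  have h1 : rho p ≤ 1 := by
    unfold rho
    exact mul_le_one₀ (inv_le_one_of_one_le₀ (by nlinarith [sq_nonneg p.1])) (by positivity)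
      (inv_le_one_of_one_le₀ (by nlinarith [sq_nonneg p.2]))
  rw [Real.norm_eq_abs, abs_of_nonneg (by positivity)]
  nlinarith

noncomputable def zz (v : S2) : S2 :=
  v + Mo true (Mo true v) + Mo false (Mo false v) + Mo false (Mo false (Mo true (Mo true v)))

lemma zz_eq (v : S2) (p : ℝ × ℝ) : v p = rho p * zz v p := by
  have h1 : (1 + p.1 ^ 2) ≠ 0 := by positivity
  have h2 : (1 + p.2 ^ 2) ≠ 0 := by positivity
  simp [zz, rho, cf]
  field_simp
  ring

lemma L1_bound : ∃ K : ℝ, 0 ≤ K ∧ ∀ v : S2, ∫ q, |v q| ≤ K * nn (zz v) := by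
  refine ⟨(∫ q : ℝ × ℝ, ‖rho q‖ ^ (2 : ℝ)) ^ (1 / (2 : ℝ)), by positivity, fun v => ?_⟩
  have h := integral_mul_norm_le_Lp_mul_Lq (μ := (volume : Measure (ℝ × ℝ))) (f := rho) (g := zz v)
    (p := 2) (q := 2) Real.HolderConjugate.two_two
    (by simpa using rho_memLp) (by simpa using (zz v).memLp 2 volume)
  have h2 : (∫ q : ℝ × ℝ, ‖zz v q‖ ^ (2 : ℝ)) ^ (1 / (2 : ℝ)) = nn (zz v) := by
    rw [← Real.sqrt_eq_rpow, ← Real.sqrt_sq (nn_nonneg (zz v)), ← ip_self, ip]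
    congr 2; ext q; simp [pow_two]
  rw [h2] at h
  refine le_trans (le_of_eq ?_) h
  congr 1; ext q
  rw [zz_eq v q, abs_mul]; rfl

noncomputable def wd : List (Bool × Bool) → S2 → S2
  | [], f => f
  | s :: w, f => wd w (Xo s f)

lemma wd_bound (w : List (Bool × Bool)) : ∃ C : ℝ, 0 ≤ C ∧ ∀ f, nn (wd w f) ≤ C * nn (Ho^[w.length] f) := by
  induction w with
  | nil => exact ⟨1, zero_le_one, fun f => by simp [wd]⟩
  | cons s w ih =>
    obtain ⟨C, hC, h⟩ := ih
    refine ⟨C * 3 ^ w.length, by positivity, fun f => (h (Xo s f)).trans ?_⟩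
    rw [mul_assoc]
    exact mul_le_mul_of_nonneg_left (nn_Ho_pow_Xo _ s f) hC

lemma sobolev : ∃ C : ℝ, 0 ≤ C ∧ ∀ f : S2, SchwartzMap.seminorm ℝ 0 0 f ≤ C * nn (Ho^[6] f) := by
  obtain ⟨K, hK, hKv⟩ := L1_bound
  obtain ⟨C1, p1, h1⟩ := wd_bound [(false, true), (false, false)]
  obtain ⟨C2, p2, h2⟩ := wd_bound [(false, true), (false, false), (true, true), (true, true)]
  obtain ⟨C3, p3, h3⟩ := wd_bound [(false, true), (false, false), (true, false), (true, false)]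
  obtain ⟨C4, p4, h4⟩ := wd_bound
    [(false, true), (false, false), (true, true), (true, true), (true, false), (true, false)]
  refine ⟨K * (C1 + C2 + C3 + C4), by positivity, fun f => ?_⟩
  refine SchwartzMap.seminorm_le_bound ℝ 0 0 f (mul_nonneg (by positivity) (nn_nonneg _)) fun p => ?_
  rw [pow_zero, one_mul, norm_iteratedFDeriv_zero, Real.norm_eq_abs]
  refine (sup_bound f p).trans ((hKv _).trans ?_)
  rw [mul_assoc]
  refine mul_le_mul_of_nonneg_left ?_ hK
  have h1 := (h1 f).trans (mul_le_mul_of_nonneg_left (nn_Ho_mono (n := 6) (by simp) f) p1)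
  have h2 := (h2 f).trans (mul_le_mul_of_nonneg_left (nn_Ho_mono (n := 6) (by simp) f) p2)
  have h3 := (h3 f).trans (mul_le_mul_of_nonneg_left (nn_Ho_mono (n := 6) (by simp) f) p3)
  have h4 := (h4 f).trans (mul_le_mul_of_nonneg_left (nn_Ho_mono (n := 6) (by simp) f) p4)
  simp only [wd, Xo, if_true, Bool.false_eq_true, if_false] at h1 h2 h3 h4
  have e1 := nn_add (Do false (Do true f) + Mo true (Mo true (Do false (Do true f)))
    + Mo false (Mo false (Do false (Do true f)))) (Mo false (Mo false (Mo true (Mo true (Do false (Do true f))))))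
  have e2 := nn_add (Do false (Do true f) + Mo true (Mo true (Do false (Do true f))))
    (Mo false (Mo false (Do false (Do true f))))
  have e3 := nn_add (Do false (Do true f)) (Mo true (Mo true (Do false (Do true f))))
  rw [zz]
  linarith

lemma seminorm_succ_right (k n : ℕ) (f : S2) : SchwartzMap.seminorm ℝ k (n + 1) f ≤
    SchwartzMap.seminorm ℝ k n (Xo (false, true) f) + SchwartzMap.seminorm ℝ k n (Xo (false, false) f) := by
  refine SchwartzMap.seminorm_le_bound ℝ k (n + 1) f (by positivity) fun p => ?_
  have hfd : fderiv ℝ f = (fun p => Do true f p • ContinuousLinearMap.fst ℝ ℝ ℝ)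
      + (fun p => Do false f p • ContinuousLinearMap.snd ℝ ℝ ℝ) := by
    funext q
    ext <;> simp [Do_apply, ev]
  have key : ∀ (g : S2) (L : ℝ × ℝ →L[ℝ] ℝ), ‖L‖ ≤ 1 →
      ‖iteratedFDeriv ℝ n (fun p => g p • L) p‖ ≤ ‖iteratedFDeriv ℝ n g p‖ := by
    intro g L hL
    have := ContinuousLinearMap.norm_iteratedFDeriv_comp_left
      (ContinuousLinearMap.toSpanSingleton ℝ L) (f := g) (x := p) (n := n)
      (g.smooth n).contDiffAt le_rfl
    refine this.trans ?_
    rw [ContinuousLinearMap.norm_toSpanSingleton]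
    exact mul_le_of_le_one_left (norm_nonneg _) hL
  have hc : ∀ (g : S2) (L : ℝ × ℝ →L[ℝ] ℝ), ContDiffAt ℝ n (fun p => g p • L) p := by
    intro g L
    exact ((g.smooth n).smul contDiff_const).contDiffAt
  rw [← norm_iteratedFDeriv_fderiv, hfd, iteratedFDeriv_add_apply (hc _ _) (hc _ _)]
  have e1 := SchwartzMap.le_seminorm ℝ k n (Do true f) p
  have e2 := SchwartzMap.le_seminorm ℝ k n (Do false f) p
  simp only [Xo, if_true, Bool.false_eq_true, if_false]
  refine le_trans ?_ (add_le_add e1 e2)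
  rw [← mul_add]
  gcongr
  exact (norm_add_le _ _).trans (add_le_add (key _ _ (ContinuousLinearMap.norm_fst_le ℝ ℝ ℝ))
    (key _ _ (ContinuousLinearMap.norm_snd_le ℝ ℝ ℝ)))

lemma seminorm_succ_left (k : ℕ) (f : S2) : SchwartzMap.seminorm ℝ (k + 1) 0 f ≤
    SchwartzMap.seminorm ℝ k 0 (Xo (true, true) f) + SchwartzMap.seminorm ℝ k 0 (Xo (true, false) f) := by
  refine SchwartzMap.seminorm_le_bound ℝ (k + 1) 0 f (by positivity) fun p => ?_
  have e1 := SchwartzMap.le_seminorm ℝ k 0 (Mo true f) p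
  have e2 := SchwartzMap.le_seminorm ℝ k 0 (Mo false f) p
  simp only [Xo, if_true, Bool.false_eq_true, if_false]
  refine le_trans ?_ (add_le_add e1 e2)
  simp only [norm_iteratedFDeriv_zero, Mo_apply, norm_mul, cf, if_true, Bool.false_eq_true, if_false, ContinuousLinearMap.coe_fst', ContinuousLinearMap.coe_snd']
  rw [← mul_add, ← add_mul, pow_succ, mul_assoc]
  gcongr
  rw [Prod.norm_def]
  exact max_le (by linarith [norm_nonneg p.2]) (by linarith [norm_nonneg p.1])

lemma seminorm_bound (k n : ℕ) : ∃ (N : ℕ) (C : ℝ), 0 ≤ C ∧ ∀ f : S2,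
    SchwartzMap.seminorm ℝ k n f ≤ C * nn (Ho^[N] f) := by
  have step : ∀ (N : ℕ) (C : ℝ) (hC : 0 ≤ C) (q : S2 → ℝ), (∀ f, q f ≤ C * nn (Ho^[N] f)) →
      ∀ s f, q (Xo s f) ≤ (C * 3 ^ N) * nn (Ho^[N + 1] f) := by
    intro N C hC q hq s f
    refine (hq _).trans ?_
    rw [mul_assoc]
    exact mul_le_mul_of_nonneg_left (nn_Ho_pow_Xo _ s f) hC
  induction n with
  | zero =>
    induction k with
    | zero => obtain ⟨C, hC, h⟩ := sobolev; exact ⟨6, C, hC, h⟩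
    | succ k ih =>
      obtain ⟨N, C, hC, h⟩ := ih
      refine ⟨N + 1, C * 3 ^ N + C * 3 ^ N, by positivity, fun f => (seminorm_succ_left k f).trans ?_⟩
      rw [add_mul]
      exact add_le_add (step N C hC _ h _ f) (step N C hC _ h _ f)
  | succ n ih =>
    obtain ⟨N, C, hC, h⟩ := ih
    refine ⟨N + 1, C * 3 ^ N + C * 3 ^ N, by positivity, fun f => (seminorm_succ_right k n f).trans ?_⟩
    rw [add_mul]
    exact add_le_add (step N C hC _ h _ f) (step N C hC _ h _ f)

lemma sup_seminorm_bound (s : Finset (ℕ × ℕ)) : ∃ (N : ℕ) (C : ℝ), 0 ≤ C ∧ ∀ f : S2,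
    s.sup (schwartzSeminormFamily ℝ (ℝ × ℝ) ℝ) f ≤ C * nn (Ho^[N] f) := by
  classical
  induction s using Finset.induction_on with
  | empty => exact ⟨0, 0, le_rfl, fun f => by simp⟩
  | insert a s _ ih =>
    obtain ⟨N, C, hC, h⟩ := ih
    obtain ⟨N', C', hC', h'⟩ := seminorm_bound a.1 a.2
    refine ⟨max N N', C + C', by positivity, fun f => ?_⟩
    rw [Finset.sup_insert, Seminorm.sup_apply]
    have e1 := (h f).trans (mul_le_mul_of_nonneg_left (nn_Ho_mono (le_max_left N N') f) hC)
    have e2 := (h' f).trans (mul_le_mul_of_nonneg_left (nn_Ho_mono (le_max_right N N') f) hC')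
    have := nn_nonneg (Ho^[max N N'] f)
    refine max_le (e2.trans ?_) (e1.trans ?_)
    · nlinarith
    · nlinarith

lemma Wo_gS (a b : ℕ) : gS a b ∈ Wo := Submodule.subset_span ⟨(a, b), rfl⟩

lemma Wo_Mo (i : Bool) {w : S2} (hw : w ∈ Wo) : Mo i w ∈ Wo := by
  unfold Wo at hw
  induction hw using Submodule.span_induction with
  | mem x hx =>
    obtain ⟨q, rfl⟩ := hx
    cases i
    · simp only [Mo_false_gS]; exact Wo_gS _ _
    · simp only [Mo_true_gS]; exact Wo_gS _ _
  | zero => rw [map_zero]; exact Wo.zero_mem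
  | add x y _ _ hx hy => rw [map_add]; exact Wo.add_mem hx hy
  | smul c x _ hx => rw [map_smul]; exact Wo.smul_mem c hx

lemma dual_apply (L : StrongDual ℝ (ℝ × ℝ)) (p : ℝ × ℝ) :
    L p = L (1, 0) * p.1 + L (0, 1) * p.2 := by
  have : p = p.1 • ((1, 0) : ℝ × ℝ) + p.2 • ((0, 1) : ℝ × ℝ) := by
    ext <;> simp
  conv_lhs => rw [this]
  rw [map_add, map_smul, map_smul]
  simp only [smul_eq_mul]; ring

lemma exists_pow_mem (L : StrongDual ℝ (ℝ × ℝ)) (n : ℕ) :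
    ∃ w ∈ Wo, ∀ p, (w : S2) p = (L p) ^ n * gf 0 0 p := by
  induction n with
  | zero => exact ⟨gS 0 0, Wo_gS 0 0, fun p => by simp⟩
  | succ n ih =>
    obtain ⟨w, hw, h⟩ := ih
    refine ⟨L (1, 0) • Mo true w + L (0, 1) • Mo false w,
      Wo.add_mem (Wo.smul_mem _ (Wo_Mo _ hw)) (Wo.smul_mem _ (Wo_Mo _ hw)), fun p => ?_⟩
    rw [add_apply, smul_apply, smul_apply, Mo_apply, Mo_apply,
      h, pow_succ]
    have hL := dual_apply L p
    simp only [cf, smul_eq_mul, if_true, Bool.false_eq_true, if_false,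
      ContinuousLinearMap.coe_fst', ContinuousLinearMap.coe_snd']
    linear_combination (-(L p ^ n * gf 0 0 p)) * hL

lemma memLp_half : MemLp (fun p : ℝ × ℝ => Real.exp (-(p.1 ^ 2 + p.2 ^ 2) / 4)) 2 volume := by
  rw [memLp_two_iff_integrable_sq (by fun_prop)]
  refine ((gS 0 0).integrable (μ := volume)).congr (Filter.Eventually.of_forall fun p => ?_)
  simp only [gS_apply, gf, pow_zero, one_mul]
  rw [← Real.exp_nat_mul]
  congr 1; push_cast; ring

lemma memLp_exp (L : StrongDual ℝ (ℝ × ℝ)) :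
    MemLp (fun p : ℝ × ℝ => Real.exp |L p| * gf 0 0 p) 2 volume := by
  refine memLp_half.of_le_mul (c := Real.exp (L (1, 0) ^ 2 + L (0, 1) ^ 2)) ?_
    (Filter.Eventually.of_forall fun p => ?_)
  · apply Continuous.aestronglyMeasurable
    unfold gf; fun_prop
  · simp only [gf, pow_zero, one_mul]
    rw [Real.norm_of_nonneg (by positivity), Real.norm_of_nonneg (by positivity), ← Real.exp_add,
      ← Real.exp_add, Real.exp_le_exp]
    have : |L p| ≤ L (1, 0) ^ 2 + L (0, 1) ^ 2 + (p.1 ^ 2 + p.2 ^ 2) / 4 := by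
      rw [dual_apply L p, abs_le]
      constructor <;> nlinarith [sq_nonneg (L (1, 0) - p.1 / 2), sq_nonneg (L (1, 0) + p.1 / 2),
        sq_nonneg (L (0, 1) - p.2 / 2), sq_nonneg (L (0, 1) + p.2 / 2)]
    linarith

lemma integrable_exp (u : Lp ℝ 2 (volume : Measure (ℝ × ℝ))) (L : StrongDual ℝ (ℝ × ℝ)) :
    Integrable (fun p => Real.exp |L p| * |u p * gf 0 0 p|) volume := by
  refine (((memLp_exp L).integrable_mul (Lp.memLp u)).abs).congr
    (Filter.Eventually.of_forall fun p => ?_)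
  simp only [Pi.mul_apply, abs_mul, Real.abs_exp]
  ring

lemma gf_cont (a b : ℕ) : Continuous (gf a b) := by unfold gf; fun_prop

lemma charint_zero (u : Lp ℝ 2 (volume : Measure (ℝ × ℝ)))
    (hu : ∀ w ∈ Wo, inner ℝ ((w : S2).toLp 2 volume) u = 0) (L : StrongDual ℝ (ℝ × ℝ)) :
    ∫ p, (u p * gf 0 0 p : ℝ) • Complex.exp (L p * Complex.I) = 0 := by
  have hmom : ∀ n : ℕ, ∫ p, (L p) ^ n * (u p * gf 0 0 p) = 0 := by
    intro n
    obtain ⟨w, hw, h⟩ := exists_pow_mem L n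
    rw [← hu w hw, L2.inner_def]
    apply integral_congr_ae
    filter_upwards [w.coeFn_toLp 2 volume] with x hf
    rw [hf, h]; simp; ring
  have hs : ∀ x : ℝ, HasSum (fun n : ℕ => x ^ n / (n.factorial : ℝ)) (Real.exp x) := fun x => by
    rw [Real.exp_eq_exp_ℝ]; exact NormedSpace.expSeries_div_hasSum_exp x
  have hc : ∀ x : ℂ, HasSum (fun n : ℕ => x ^ n / (n.factorial : ℂ)) (Complex.exp x) := fun x => by
    rw [Complex.exp_eq_exp_ℂ]; exact NormedSpace.expSeries_div_hasSum_exp x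
  have hum : AEStronglyMeasurable (fun p => u p * gf 0 0 p) volume :=
    (Lp.aestronglyMeasurable u).mul (gf_cont 0 0).aestronglyMeasurable
  have key := hasSum_integral_of_dominated_convergence (μ := (volume : Measure (ℝ × ℝ)))
    (F := fun (n : ℕ) p => (u p * gf 0 0 p : ℝ) • ((L p * Complex.I) ^ n / (n.factorial : ℂ)))
    (f := fun p => (u p * gf 0 0 p : ℝ) • Complex.exp (L p * Complex.I))
    (fun n p => |L p| ^ n / n.factorial * |u p * gf 0 0 p|) ?_ ?_ ?_ ?_ ?_
  · refine key.unique ?_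
    suffices hz : ∀ n : ℕ, ∫ p, (u p * gf 0 0 p : ℝ) •
        (((L p : ℂ) * Complex.I) ^ n / (n.factorial : ℂ)) = 0 by
      simp only [hz]; exact hasSum_zero
    intro n
    have : ∀ p, (u p * gf 0 0 p : ℝ) • (((L p : ℂ) * Complex.I) ^ n / (n.factorial : ℂ)) =
        (((L p) ^ n * (u p * gf 0 0 p) : ℝ) : ℂ) * (Complex.I ^ n / (n.factorial : ℂ)) := by
      intro p
      rw [Complex.real_smul, mul_pow]; push_cast; ring
    simp_rw [this]
    rw [integral_mul_const, integral_complex_ofReal, hmom]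
    simp
  · intro n
    exact hum.smul (Continuous.aestronglyMeasurable (by fun_prop))
  · intro n
    refine Filter.Eventually.of_forall fun p => ?_
    rw [norm_smul, norm_div, norm_pow, norm_mul]
    simp [mul_comm]
  · refine Filter.Eventually.of_forall fun p => ?_
    exact ((hs _).mul_right _).summable
  · refine (integrable_exp u L).congr (Filter.Eventually.of_forall fun p => ?_)
    exact ((hs _).mul_right _).tsum_eq.symm
  · refine Filter.Eventually.of_forall fun p => ?_
    exact (hc _).const_smul _

lemma eq_zero_of_orth (u : Lp ℝ 2 (volume : Measure (ℝ × ℝ)))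
    (hu : ∀ w ∈ Wo, inner ℝ ((w : S2).toLp 2 volume) u = 0) : u = 0 := by
  set φ : ℝ × ℝ → ℝ := fun p => u p * gf 0 0 p with hφ
  have hum : AEStronglyMeasurable φ volume :=
    (Lp.aestronglyMeasurable u).mul (gf_cont 0 0).aestronglyMeasurable
  have hi : Integrable φ volume := by
    have := integrable_exp u 0
    simp only [zero_apply, abs_zero, Real.exp_zero, one_mul] at this
    rw [← integrable_norm_iff hum]; exact this
  have := isFiniteMeasure_withDensity_ofReal hi.2
  have := isFiniteMeasure_withDensity_ofReal hi.neg.2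
  have hm1 : AEMeasurable (fun x => ENNReal.ofReal (φ x)) volume := hum.aemeasurable.ennreal_ofReal
  have hm2 : AEMeasurable (fun x => ENNReal.ofReal ((-φ) x)) volume :=
    hum.neg.aemeasurable.ennreal_ofReal
  have heq : (volume : Measure (ℝ × ℝ)).withDensity (fun x => ENNReal.ofReal (φ x)) =
      (volume : Measure (ℝ × ℝ)).withDensity (fun x => ENNReal.ofReal ((-φ) x)) := by
    apply Measure.ext_of_charFunDual
    ext L
    rw [charFunDual_apply, charFunDual_apply,
      integral_withDensity_eq_integral_toReal_smul₀ hm1 (by simp),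
      integral_withDensity_eq_integral_toReal_smul₀ hm2 (by simp), ← sub_eq_zero, ← integral_sub]
    · rw [← charint_zero u hu L]
      congr 1; ext p
      rw [← sub_smul, ENNReal.toReal_ofReal', ENNReal.toReal_ofReal', Pi.neg_apply]
      congr 1
      exact max_zero_sub_max_neg_zero_eq_self (φ p)
    · refine Integrable.smul_bdd (𝕜 := ℝ) (C := 1) ?_ ?_ ?_
      · simp only [ENNReal.toReal_ofReal']; exact hi.pos_part
      · exact Continuous.aestronglyMeasurable (by fun_prop)
      · exact Filter.Eventually.of_forall fun p => (Complex.norm_exp_ofReal_mul_I _).le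
    · refine Integrable.smul_bdd (𝕜 := ℝ) (C := 1) ?_ ?_ ?_
      · simp only [ENNReal.toReal_ofReal']; exact hi.neg.pos_part
      · exact Continuous.aestronglyMeasurable (by fun_prop)
      · exact Filter.Eventually.of_forall fun p => (Complex.norm_exp_ofReal_mul_I _).le
  rw [withDensity_eq_iff_of_sigmaFinite hm1 hm2] at heq
  rw [Lp.eq_zero_iff_ae_eq_zero]
  filter_upwards [heq] with p hp
  have h2 := congrArg ENNReal.toReal hp
  rw [ENNReal.toReal_ofReal', ENNReal.toReal_ofReal', Pi.neg_apply] at h2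
  have h0 : φ p = 0 := by
    have := max_zero_sub_max_neg_zero_eq_self (φ p)
    rw [← this, h2, sub_self]
  have hpos : gf 0 0 p ≠ 0 := by simp [gf]
  exact (mul_eq_zero.mp h0).resolve_right hpos

lemma Wo_L2_dense (v : Lp ℝ 2 (volume : Measure (ℝ × ℝ))) {ε : ℝ} (hε : 0 < ε) :
    ∃ w ∈ Wo, ‖v - (w : S2).toLp 2 volume‖ < ε := by
  set K : Submodule ℝ (Lp ℝ 2 (volume : Measure (ℝ × ℝ))) :=
    Wo.map (toLpCLM ℝ ℝ 2 (volume : Measure (ℝ × ℝ))).toLinearMap with hK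
  have h : K.topologicalClosure = ⊤ := by
    rw [Submodule.topologicalClosure_eq_top_iff, Submodule.eq_bot_iff]
    intro u hu
    apply eq_zero_of_orth
    intro w hw
    exact (Submodule.mem_orthogonal _ _).mp hu _ ⟨w, hw, rfl⟩
  have hv : v ∈ closure (K : Set (Lp ℝ 2 (volume : Measure (ℝ × ℝ)))) := by
    rw [← Submodule.topologicalClosure_coe, h]; trivial
  obtain ⟨_, ⟨w, hw, rfl⟩, hd⟩ := Metric.mem_closure_iff.mp hv ε hε
  exact ⟨w, hw, by rw [← dist_eq_norm]; exact hd⟩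

lemma Wo_dense : Dense (Wo : Set S2) := by
  intro f
  rw [mem_closure_iff_nhds_basis ((schwartz_withSeminorms ℝ (ℝ × ℝ) ℝ).hasBasis_ball (x := f))]
  rintro ⟨s, ε⟩ hε
  obtain ⟨N, C, hC, hb⟩ := sup_seminorm_bound s
  have hε' : 0 < ε / (C + 1) := div_pos hε (by linarith)
  obtain ⟨w, hw, hd⟩ := Wo_L2_dense ((Ho^[N] f).toLp 2 volume) hε'
  obtain ⟨v, hv, hvw⟩ := Wo_surj_pow N w hw
  refine ⟨v, hv, ?_⟩
  rw [Seminorm.mem_ball, map_sub_rev]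
  have hl : Ho^[N] (f - v) = Ho^[N] f - w := by
    rw [← hvw]
    simp only [← FunLike.coe_pow_eq_iterate, map_sub]
  have h1 := hb (f - v)
  rw [hl] at h1
  have h2 : nn (Ho^[N] f - w) < ε / (C + 1) := hd
  calc _ ≤ C * nn (Ho^[N] f - w) := h1
    _ ≤ C * (ε / (C + 1)) := by gcongr
    _ < (C + 1) * (ε / (C + 1)) := by nlinarith
    _ = ε := by field_simp

end MGD

theorem monomial_gaussian_span_dense :
    Dense (↑(Submodule.span ℝ
      {f : SchwartzMap (ℝ × ℝ) ℝ | ∃ m n : ℕ, m ≤ n ∧ ∀ p : ℝ × ℝ,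
        f p = p.1 ^ (n - m) * p.2 ^ m * Real.exp (-(p.1 ^ 2 + p.2 ^ 2) / 2)}) :
      Set (SchwartzMap (ℝ × ℝ) ℝ)) := by
  refine MGD.Wo_dense.mono ?_
  apply Submodule.span_mono
  rintro _ ⟨q, rfl⟩
  refine ⟨q.2, q.1 + q.2, Nat.le_add_left _ _, fun p => ?_⟩
  simp [MGD.gf]
end

section
/- Let ρ ∈ S(ℝ²) be a density-matrix kernel, i.e., the associated integral operator T on L²(ℝ) is positive and Tr T = ∫_ℝ ρ(x,x) dx = 1. Then for each fixed φ, the tomogram X ↦ ω_T(X, φ) is a probability density: it is nonnegative and ∫_ℝ ω_T(X, φ) dX = 1. -/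
open MeasureTheory Filter Topology

def TomoS : Set ℂ := (fun c : ℝ => (c : ℂ)) '' Set.Ici 0

lemma tomoS_closed : IsClosed TomoS :=
  Complex.isometry_ofReal.isClosedEmbedding.isClosedMap _ isClosed_Ici

lemma tomo_mem_iff (z : ℂ) : z ∈ TomoS ↔ ∃ c : ℝ, 0 ≤ c ∧ z = c := by
  constructor
  · rintro ⟨c, hc, rfl⟩; exact ⟨c, hc, rfl⟩
  · rintro ⟨c, hc, rfl⟩; exact ⟨c, hc, rfl⟩

lemma tomo_diag (ρ : SchwartzMap (ℝ × ℝ) ℂ)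
    (hpos : ∀ f : SchwartzMap ℝ ℂ, ∃ c : ℝ, 0 ≤ c ∧
      (∫ x : ℝ, ∫ y : ℝ, (starRingEnd ℂ) (f x) * ρ (x, y) * f y) = c) (x₀ : ℝ) :
    ρ (x₀, x₀) ∈ TomoS := by
  rw [← tomoS_closed.closure_eq, Metric.mem_closure_iff]
  intro ε hε
  obtain ⟨δ, hδ, H⟩ := Metric.continuousAt_iff.1 (ρ.continuous.continuousAt (x := (x₀, x₀)))
    (ε / 2) (by positivity)
  let b : ContDiffBump x₀ := ⟨δ / 2, δ, by positivity, by linarith⟩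
  let g : ℝ → ℂ := fun x => (b.normed volume x : ℂ)
  have hg1 : HasCompactSupport g := by
    exact (b.hasCompactSupport_normed (μ := volume)).comp_left (g := fun c : ℝ => (c : ℂ)) (by simp)
  have hg2 : ContDiff ℝ (⊤ : ℕ∞) g :=
    Complex.ofRealCLM.contDiff.comp (b.contDiff_normed (μ := volume))
  have hgi : Integrable g := (b.integrable_normed (μ := volume)).ofReal
  have hP := hpos (hg1.toSchwartzMap hg2)
  rw [← tomo_mem_iff] at hP
  refine ⟨_, hP, ?_⟩
  have hw : Integrable (fun p : ℝ × ℝ => b.normed volume p.1 * b.normed volume p.2)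
      (volume.prod volume) :=
    (b.integrable_normed (μ := volume)).mul_prod (b.integrable_normed (μ := volume))
  have hwI : ∫ p : ℝ × ℝ, b.normed volume p.1 * b.normed volume p.2 = 1 := by
    have := integral_prod_mul (μ := (volume : Measure ℝ)) (ν := (volume : Measure ℝ))
      (b.normed volume) (b.normed volume)
    rw [b.integral_normed] at this
    rw [Measure.volume_eq_prod]; simpa using this
  have hwc : Integrable (fun p : ℝ × ℝ => g p.1 * g p.2) (volume.prod volume) := hgi.mul_prod hgi
  have hwIc : ∫ p : ℝ × ℝ, g p.1 * g p.2 = 1 := by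
    have : ∫ p : ℝ × ℝ, g p.1 * g p.2
        = ∫ p : ℝ × ℝ, ((b.normed volume p.1 * b.normed volume p.2 : ℝ) : ℂ) := by
      congr 1; ext p; simp [g]
    rw [this, integral_complex_ofReal, hwI]; simp
  have hint : Integrable (fun p : ℝ × ℝ => (starRingEnd ℂ) (g p.1) * ρ p * g p.2)
      (volume.prod volume) := by
    have h1 := hwc.mul_bdd (c := SchwartzMap.seminorm ℝ 0 0 ρ) (g := ρ)
      ρ.continuous.aestronglyMeasurable
      (Eventually.of_forall fun p => by simpa using ρ.norm_le_seminorm ℝ p)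
    refine h1.congr (Eventually.of_forall fun p => ?_)
    simp [g]; ring
  have e1 : (∫ x : ℝ, ∫ y : ℝ, (starRingEnd ℂ) ((hg1.toSchwartzMap hg2) x) * ρ (x, y) *
      (hg1.toSchwartzMap hg2) y) = ∫ p : ℝ × ℝ, (starRingEnd ℂ) (g p.1) * ρ p * g p.2 := by
    rw [Measure.volume_eq_prod, integral_prod _ hint]; rfl
  have e2 : ρ (x₀, x₀) = ∫ p : ℝ × ℝ, g p.1 * g p.2 * ρ (x₀, x₀) := by
    rw [integral_mul_const, hwIc, one_mul]
  rw [e1, dist_comm, dist_eq_norm]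
  nth_rewrite 1 [e2]
  rw [Measure.volume_eq_prod, ← integral_sub hint (hwc.mul_const _)]
  refine lt_of_le_of_lt (norm_integral_le_of_norm_le (hw.mul_const (ε / 2))
    (Eventually.of_forall fun p => ?_)) ?_
  · have : (starRingEnd ℂ) (g p.1) * ρ p * g p.2 - g p.1 * g p.2 * ρ (x₀, x₀)
        = ((b.normed volume p.1 * b.normed volume p.2 : ℝ) : ℂ) * (ρ p - ρ (x₀, x₀)) := by
      simp [g]; ring
    rw [this, norm_mul, Complex.norm_real]
    have hn : 0 ≤ b.normed volume p.1 * b.normed volume p.2 :=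
      mul_nonneg (b.nonneg_normed _) (b.nonneg_normed _)
    rw [Real.norm_of_nonneg hn]
    by_cases hp : p ∈ Metric.ball (x₀, x₀) δ
    · have := H hp
      rw [dist_eq_norm] at this
      gcongr
    · have : b.normed volume p.1 * b.normed volume p.2 = 0 := by
        by_contra hne
        apply hp
        have h1 : p.1 ∈ Function.support (b.normed volume) := left_ne_zero_of_mul hne
        have h2 : p.2 ∈ Function.support (b.normed volume) := right_ne_zero_of_mul hne
        rw [b.support_normed_eq] at h1 h2
        rw [Metric.mem_ball, Prod.dist_eq]
        exact max_lt h1 h2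
      rw [this]; simp
  · rw [integral_mul_const, ← Measure.volume_eq_prod, hwI]; linarith

lemma tomo_phase (ρ : SchwartzMap (ℝ × ℝ) ℂ)
    (hpos : ∀ f : SchwartzMap ℝ ℂ, ∃ c : ℝ, 0 ≤ c ∧
      (∫ x : ℝ, ∫ y : ℝ, (starRingEnd ℂ) (f x) * ρ (x, y) * f y) = c)
    (g : ℝ → ℂ) (hg : ContDiff ℝ (⊤ : ℕ∞) g) (hg1 : ∀ x, ‖g x‖ = 1) :
    (∫ x : ℝ, ∫ y : ℝ, (starRingEnd ℂ) (g x) * ρ (x, y) * g y) ∈ TomoS := by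
  let b : ℕ → ContDiffBump (0 : ℝ) := fun n => ⟨n + 1, n + 2, by positivity, by linarith⟩
  let G : ℕ → ℝ → ℂ := fun n x => (b n x : ℂ) * g x
  have hG1 : ∀ n, HasCompactSupport (G n) := fun n =>
    ((b n).hasCompactSupport.comp_left (g := fun c : ℝ => (c : ℂ)) (by simp)).mul_right
  have hG2 : ∀ n, ContDiff ℝ (⊤ : ℕ∞) (G n) := fun n =>
    (Complex.ofRealCLM.contDiff.comp (b n).contDiff).mul hg
  have hGle : ∀ n x, ‖G n x‖ ≤ 1 := fun n x => by
    simp only [G, norm_mul, hg1, mul_one, Complex.norm_real]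
    rw [Real.norm_of_nonneg (b n).nonneg]; exact (b n).le_one
  have key : ∀ f : ℝ → ℂ, Continuous f → (∀ x, ‖f x‖ ≤ 1) →
      Integrable (fun p : ℝ × ℝ => (starRingEnd ℂ) (f p.1) * ρ p * f p.2)
      (volume.prod volume) := by
    intro f hf hf1
    refine (ρ.integrable (μ := volume)).mono (by
      apply Continuous.aestronglyMeasurable
      have := ρ.continuous
      fun_prop) (Eventually.of_forall fun p => ?_)
    rw [norm_mul, norm_mul, RCLike.norm_conj]
    calc _ ≤ 1 * ‖ρ p‖ * 1 := by gcongr <;> apply hf1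
      _ = _ := by ring
  have h0 := key g hg.continuous (fun x => (hg1 x).le)
  have hn := fun n => key (G n) (hG2 n).continuous (hGle n)
  have e0 := integral_prod _ h0
  simp only at e0
  rw [← e0]
  have hlim : Tendsto (fun n => ∫ p, (starRingEnd ℂ) (G n p.1) * ρ p * G n p.2 ∂(volume.prod volume))
      atTop (𝓝 (∫ p, (starRingEnd ℂ) (g p.1) * ρ p * g p.2 ∂(volume.prod volume))) := by
    refine tendsto_integral_of_dominated_convergence (fun p => ‖ρ p‖)
      (fun n => (hn n).aestronglyMeasurable) (ρ.integrable (μ := volume)).norm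
      (fun n => Eventually.of_forall fun p => ?_) (Eventually.of_forall fun p => ?_)
    · rw [norm_mul, norm_mul, RCLike.norm_conj]
      calc _ ≤ 1 * ‖ρ p‖ * 1 := by gcongr <;> apply hGle
        _ = _ := by ring
    · have hev : ∀ x, ∀ᶠ n in atTop, G n x = g x := by
        intro x
        obtain ⟨N, hN⟩ := exists_nat_ge |x|
        filter_upwards [eventually_ge_atTop N] with n hnN
        have : b n x = 1 := by
          apply (b n).one_of_mem_closedBall
          have : (N : ℝ) ≤ n := by exact_mod_cast hnN
          simp [b]; linarith
        simp [G, this]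
      apply tendsto_const_nhds.congr'
      filter_upwards [hev p.1, hev p.2] with n h1 h2
      rw [h1, h2]
  refine tomoS_closed.mem_of_tendsto hlim (Eventually.of_forall fun n => ?_)
  rw [integral_prod _ (hn n)]
  exact (tomo_mem_iff _).2 (hpos ((hG1 n).toSchwartzMap (hG2 n)))

open scoped FourierTransform RealInnerProductSpace in
lemma tomo_fourier_integrable (f : ℝ → ℂ) (hf : Integrable f) (hc : ContinuousAt f 0)
    (hn : ∀ w, 𝓕 f w ∈ TomoS) : Integrable (𝓕 f) := by
  have hcont : Continuous (𝓕 f) :=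
    VectorFourier.fourierIntegral_continuous Real.continuous_fourierChar
      (by exact continuous_inner) hf
  have hbd : ∀ w, ‖𝓕 f w‖ ≤ ∫ v, ‖f v‖ := fun w =>
    VectorFourier.norm_fourierIntegral_le_integral_norm _ _ _ _ _
  have hre : ∀ w, 𝓕 f w = (‖𝓕 f w‖ : ℂ) := by
    intro w
    obtain ⟨c, hc, h⟩ := hn w
    simp only at h
    rw [← h, Complex.norm_real, Real.norm_of_nonneg hc]
  have A := Real.tendsto_integral_gaussian_smul' hf hc
  have B : Tendsto (fun (c : ℝ) ↦ (∫ w : ℝ, Complex.exp (- (c:ℂ)⁻¹ * ‖w‖ ^ 2) • (𝓕 f) w)) atTop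
      (𝓝 (f 0)) := by
    apply A.congr'
    filter_upwards [Ioi_mem_atTop 0] with c (hc : 0 < c)
    have J : Integrable (fun w : ℝ ↦ Complex.exp (- (c:ℂ)⁻¹ * ‖w‖ ^ 2 + 2 * Real.pi * Complex.I * ⟪(0:ℝ), w⟫)) :=
      GaussianFourier.integrable_cexp_neg_mul_sq_norm_add (by simpa) _ _
    have := (VectorFourier.integral_fourierIntegral_smul_eq_flip (L := innerₗ ℝ)
      Real.continuous_fourierChar continuous_inner J hf)
    have h2 : ∫ w : ℝ, 𝓕 (fun w : ℝ ↦ Complex.exp (- (c:ℂ)⁻¹ * ‖w‖ ^ 2 + 2 * Real.pi * Complex.I * ⟪(0:ℝ), w⟫)) w • f w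
       = ∫ w : ℝ, Complex.exp (- (c:ℂ)⁻¹ * ‖w‖ ^ 2 + 2 * Real.pi * Complex.I * ⟪(0:ℝ), w⟫) • 𝓕 f w := by
      simpa using! this
    trans ∫ w : ℝ, 𝓕 (fun w : ℝ ↦ Complex.exp (- (c:ℂ)⁻¹ * ‖w‖ ^ 2 + 2 * Real.pi * Complex.I * ⟪(0:ℝ), w⟫)) w • f w
    · congr with w
      rw [fourier_gaussian_innerProductSpace' (by simpa)]
      congr 2
      · simp
      · congr 1; simp; ring
    · rw [h2]; simp
  have C : ∀ᶠ c : ℝ in atTop, ‖∫ w : ℝ, Complex.exp (- (c:ℂ)⁻¹ * ‖w‖ ^ 2) • (𝓕 f) w‖ < ‖f 0‖ + 1 :=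
    B.norm.eventually (gt_mem_nhds (by linarith))
  refine integrable_of_intervalIntegral_norm_bounded (l := atTop) (a := fun n : ℕ => -(n : ℝ))
    (b := fun n : ℕ => (n : ℝ)) (Real.exp 1 * (‖f 0‖ + 1))
    (fun n => hcont.integrableOn_Ioc) (tendsto_neg_atTop_atBot.comp tendsto_natCast_atTop_atTop)
    tendsto_natCast_atTop_atTop (Eventually.of_forall fun n => ?_)
  obtain ⟨c, hcC, hc1, hcn⟩ := (C.and ((eventually_ge_atTop (1 : ℝ)).and
    (eventually_ge_atTop ((n : ℝ) ^ 2)))).exists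
  have hc0 : 0 < c := by linarith
  have e : ∫ w : ℝ, Complex.exp (- (c:ℂ)⁻¹ * ‖w‖ ^ 2) • (𝓕 f) w
      = ((∫ w : ℝ, Real.exp (-c⁻¹ * w ^ 2) * ‖𝓕 f w‖ : ℝ) : ℂ) := by
    rw [← integral_complex_ofReal]
    congr with w
    rw [hre w]
    push_cast
    rw [← Complex.ofReal_pow, Real.norm_eq_abs, sq_abs]
    simp
  have hint : Integrable (fun w : ℝ => Real.exp (-c⁻¹ * w ^ 2) * ‖𝓕 f w‖) :=
    (integrable_exp_neg_mul_sq (inv_pos.2 hc0)).mul_bdd (c := ∫ v, ‖f v‖)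
      hcont.norm.aestronglyMeasurable (Eventually.of_forall fun w => by simpa using hbd w)
  have hnn : ∀ w, 0 ≤ Real.exp (-c⁻¹ * w ^ 2) * ‖𝓕 f w‖ := fun w => by positivity
  rw [e, Complex.norm_real, Real.norm_of_nonneg (integral_nonneg hnn)] at hcC
  have hle : (-(n : ℝ)) ≤ n := by have : (0 : ℝ) ≤ n := n.cast_nonneg; linarith
  rw [intervalIntegral.integral_of_le hle]
  calc ∫ w in Set.Ioc (-(n:ℝ)) n, ‖𝓕 f w‖
      ≤ ∫ w in Set.Ioc (-(n:ℝ)) n, Real.exp 1 * (Real.exp (-c⁻¹ * w ^ 2) * ‖𝓕 f w‖) := by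
        refine setIntegral_mono_on hcont.norm.integrableOn_Ioc (hint.const_mul _).integrableOn
          measurableSet_Ioc fun w hw => ?_
        rw [← mul_assoc, ← Real.exp_add]
        refine le_mul_of_one_le_left (norm_nonneg _) (Real.one_le_exp ?_)
        have : w ^ 2 ≤ c := le_trans (sq_le_sq' hw.1.le hw.2) hcn
        have : c⁻¹ * w ^ 2 ≤ 1 := by
          rw [inv_mul_le_iff₀ hc0]; linarith
        linarith
    _ ≤ ∫ w, Real.exp 1 * (Real.exp (-c⁻¹ * w ^ 2) * ‖𝓕 f w‖) :=
        setIntegral_le_integral (hint.const_mul _)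
          (Eventually.of_forall fun w => mul_nonneg (Real.exp_pos _).le (hnn w))
    _ = Real.exp 1 * ∫ w, (Real.exp (-c⁻¹ * w ^ 2) * ‖𝓕 f w‖) := integral_const_mul _ _
    _ ≤ _ := by gcongr

lemma tomo_smul {z : ℂ} (hz : z ∈ TomoS) {r : ℝ} (hr : 0 ≤ r) : (r : ℂ) * z ∈ TomoS := by
  obtain ⟨c, hc, rfl⟩ := hz
  exact ⟨r * c, mul_nonneg hr hc, by simp⟩

/-- the shear `(t, x) ↦ (x, x + σ t)` -/
noncomputable def tomoShear (σ : ℝ) (hσ : σ ≠ 0) : (ℝ × ℝ) ≃L[ℝ] (ℝ × ℝ) :=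
  ContinuousLinearEquiv.equivOfInverse
    ((ContinuousLinearMap.snd ℝ ℝ ℝ).prod
      (ContinuousLinearMap.snd ℝ ℝ ℝ + σ • ContinuousLinearMap.fst ℝ ℝ ℝ))
    ((σ⁻¹ • (ContinuousLinearMap.snd ℝ ℝ ℝ - ContinuousLinearMap.fst ℝ ℝ ℝ)).prod
      (ContinuousLinearMap.fst ℝ ℝ ℝ))
    (fun p => by ext <;> simp [hσ])
    (fun p => by ext <;> simp [hσ])

lemma tomo_shear_integrable (ρ : SchwartzMap (ℝ × ℝ) ℂ) (σ : ℝ) (hσ : σ ≠ 0) :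
    Integrable (fun p : ℝ × ℝ => ρ (p.2, p.2 + σ * p.1)) (volume.prod volume) :=
  (SchwartzMap.compCLMOfContinuousLinearEquiv ℂ (tomoShear σ hσ) ρ).integrable (μ := volume)

/-- the quadratic phase -/
noncomputable def tomoG (k σ X : ℝ) (y : ℝ) : ℂ :=
  Complex.exp (((y ^ 2 * k / (2 * σ) - X * y / σ : ℝ) : ℂ) * Complex.I)

lemma tomoG_norm (k σ X y : ℝ) : ‖tomoG k σ X y‖ = 1 := Complex.norm_exp_ofReal_mul_I _

lemma tomoG_contDiff (k σ X : ℝ) : ContDiff ℝ (⊤ : ℕ∞) (tomoG k σ X) := by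
  unfold tomoG
  apply ContDiff.cexp
  apply ContDiff.mul _ contDiff_const
  have h : ContDiff ℝ (⊤ : ℕ∞) (fun y : ℝ => y ^ 2 * k / (2 * σ) - X * y / σ) := by fun_prop
  exact Complex.ofRealCLM.contDiff.comp h

lemma tomoG_mul (k σ X s t : ℝ) (hσ : σ ≠ 0) (z : ℂ) :
    Complex.exp (Complex.I * (s * k - X) * t) * z =
    (starRingEnd ℂ) (tomoG k σ X (s - t * σ / 2)) * z * tomoG k σ X (s + t * σ / 2) := by
  unfold tomoG
  rw [← Complex.exp_conj, mul_right_comm _ z, ← Complex.exp_add]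
  congr 2
  have : (σ : ℂ) ≠ 0 := by exact_mod_cast hσ
  simp only [map_mul, Complex.conj_ofReal, Complex.conj_I]
  push_cast
  field_simp
  ring

lemma tomo_inner (ρ : SchwartzMap (ℝ × ℝ) ℂ) (k σ X t : ℝ) (hσ : σ ≠ 0) :
    (∫ s : ℝ, Complex.exp (Complex.I * (s * k - X) * t) *
        ρ (s - t * σ / 2, s + t * σ / 2)) =
    ∫ x : ℝ, (starRingEnd ℂ) (tomoG k σ X x) * ρ (x, x + σ * t) * tomoG k σ X (x + σ * t) := by
  rw [← integral_sub_right_eq_self (fun x : ℝ => (starRingEnd ℂ) (tomoG k σ X x) *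
    ρ (x, x + σ * t) * tomoG k σ X (x + σ * t)) (t * σ / 2)]
  congr with s
  rw [tomoG_mul _ _ _ _ _ hσ]
  have : s - t * σ / 2 + σ * t = s + t * σ / 2 := by ring
  rw [this]

lemma tomo_prod_integrable (ρ : SchwartzMap (ℝ × ℝ) ℂ) (k σ X : ℝ) (hσ : σ ≠ 0) :
    Integrable (fun p : ℝ × ℝ => (starRingEnd ℂ) (tomoG k σ X p.2) * ρ (p.2, p.2 + σ * p.1) *
      tomoG k σ X (p.2 + σ * p.1)) (volume.prod volume) := by
  refine (tomo_shear_integrable ρ σ hσ).mono ?_ (Eventually.of_forall fun p => ?_)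
  · apply Continuous.aestronglyMeasurable
    have := ρ.continuous
    have := (tomoG_contDiff k σ X).continuous
    fun_prop
  · simp [tomoG_norm]

lemma tomo_pos (ρ : SchwartzMap (ℝ × ℝ) ℂ)
    (hpos : ∀ f : SchwartzMap ℝ ℂ, ∃ c : ℝ, 0 ≤ c ∧
      (∫ x : ℝ, ∫ y : ℝ, (starRingEnd ℂ) (f x) * ρ (x, y) * f y) = c)
    (k σ X : ℝ) (hσ : σ ≠ 0) :
    (∫ t : ℝ, ∫ s : ℝ, Complex.exp (Complex.I * (s * k - X) * t) *
        ρ (s - t * σ / 2, s + t * σ / 2)) ∈ TomoS := by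
  simp_rw [fun t => tomo_inner ρ k σ X t hσ]
  rw [integral_integral_swap (tomo_prod_integrable ρ k σ X hσ)]
  have : ∀ x : ℝ, ∫ t : ℝ, (starRingEnd ℂ) (tomoG k σ X x) * ρ (x, x + σ * t) *
      tomoG k σ X (x + σ * t) = (|σ⁻¹| : ℝ) * ∫ y : ℝ, (starRingEnd ℂ) (tomoG k σ X x) * ρ (x, y) *
      tomoG k σ X y := by
    intro x
    rw [Measure.integral_comp_mul_left (fun u => (starRingEnd ℂ) (tomoG k σ X x) * ρ (x, x + u) *
      tomoG k σ X (x + u)) σ, integral_add_left_eq_self (fun u =>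
      (starRingEnd ℂ) (tomoG k σ X x) * ρ (x, u) * tomoG k σ X u) x, Complex.real_smul]
  simp_rw [this]
  rw [integral_const_mul]
  exact tomo_smul (tomo_phase ρ hpos _ (tomoG_contDiff k σ X) (tomoG_norm k σ X)) (abs_nonneg _)

noncomputable def tomoF (ρ : SchwartzMap (ℝ × ℝ) ℂ) (k σ t : ℝ) : ℂ :=
  ∫ s : ℝ, Complex.exp (Complex.I * (s * k) * t) * ρ (s - t * σ / 2, s + t * σ / 2)

lemma tomoF_integrable (ρ : SchwartzMap (ℝ × ℝ) ℂ) (k σ : ℝ) (hσ : σ ≠ 0) :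
    Integrable (tomoF ρ k σ) := by
  have := (tomo_prod_integrable ρ k σ 0 hσ).integral_prod_left
  refine this.congr (Eventually.of_forall fun t => ?_)
  simp only
  rw [← tomo_inner ρ k σ 0 t hσ, tomoF]
  simp

lemma tomo_decay (ρ : SchwartzMap (ℝ × ℝ) ℂ) : ∃ C : ℝ, ∀ s a : ℝ,
    ‖ρ (s - a, s + a)‖ ≤ C * (1 + s ^ 2)⁻¹ := by
  obtain ⟨C0, -, h0⟩ := ρ.decay 0 0
  obtain ⟨C2, -, h2⟩ := ρ.decay 2 0
  refine ⟨C0 + C2, fun s a => ?_⟩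
  have h0 := h0 (s - a, s + a)
  have h2 := h2 (s - a, s + a)
  simp only [norm_iteratedFDeriv_zero, pow_zero, one_mul] at h0 h2
  have hs : |s| ≤ ‖(s - a, s + a)‖ := by
    rw [Prod.norm_def]
    simp only [Real.norm_eq_abs]
    have h1 := le_max_left |s - a| |s + a|
    have h3 := le_max_right |s - a| |s + a|
    have h4 : |2 * s| ≤ |s - a| + |s + a| := by
      have := abs_add_le (s - a) (s + a); ring_nf at this ⊢; exact this
    rw [abs_mul, abs_two] at h4
    linarith
  have hs2 : s ^ 2 ≤ ‖(s - a, s + a)‖ ^ 2 := by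
    rw [← sq_abs s]; gcongr
  rw [← div_eq_mul_inv, le_div_iff₀ (by positivity)]
  nlinarith [norm_nonneg (ρ (s - a, s + a)), mul_le_mul_of_nonneg_right hs2 (norm_nonneg (ρ (s - a, s + a)))]

lemma tomoF_continuous (ρ : SchwartzMap (ℝ × ℝ) ℂ) (k σ : ℝ) :
    Continuous (tomoF ρ k σ) := by
  obtain ⟨C, hC⟩ := tomo_decay ρ
  have hρ := ρ.continuous
  refine continuous_of_dominated (bound := fun s => C * (1 + s ^ 2)⁻¹) (fun t => ?_)
    (fun t => Eventually.of_forall fun s => ?_) (integrable_inv_one_add_sq.const_mul C)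
    (Eventually.of_forall fun s => ?_)
  · apply Continuous.aestronglyMeasurable; fun_prop
  · have : Complex.I * (s * k) * t = ((s * k * t : ℝ) : ℂ) * Complex.I := by push_cast; ring
    rw [norm_mul, this, Complex.norm_exp_ofReal_mul_I, one_mul]
    exact hC _ _
  · fun_prop

open scoped FourierTransform in
lemma tomo_outer (ρ : SchwartzMap (ℝ × ℝ) ℂ) (k σ X : ℝ) :
    (∫ t : ℝ, ∫ s : ℝ, Complex.exp (Complex.I * (s * k - X) * t) *
        ρ (s - t * σ / 2, s + t * σ / 2)) = 𝓕 (tomoF ρ k σ) ((2 * Real.pi)⁻¹ * X) := by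
  rw [Real.fourier_real_eq_integral_exp_smul]
  congr with t
  rw [tomoF, smul_eq_mul, ← integral_const_mul]
  congr with s
  rw [← mul_assoc, ← Complex.exp_add]
  congr 2
  have : (Real.pi : ℂ) ≠ 0 := by exact_mod_cast Real.pi_ne_zero
  push_cast
  field_simp
  ring

open scoped FourierTransform in
lemma tomo_total (ρ : SchwartzMap (ℝ × ℝ) ℂ)
    (hpos : ∀ f : SchwartzMap ℝ ℂ, ∃ c : ℝ, 0 ≤ c ∧
      (∫ x : ℝ, ∫ y : ℝ, (starRingEnd ℂ) (f x) * ρ (x, y) * f y) = c)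
    (htr : (∫ x : ℝ, ρ (x, x)) = 1)
    (k σ : ℝ) (hσ : σ ≠ 0) :
    ∫ X : ℝ, ((1 / (2 * Real.pi) : ℝ) : ℂ) * (∫ t : ℝ, ∫ s : ℝ,
      Complex.exp (Complex.I * (s * k - X) * t) * ρ (s - t * σ / 2, s + t * σ / 2)) = 1 := by
  have hn : ∀ w, 𝓕 (tomoF ρ k σ) w ∈ TomoS := by
    intro w
    have := tomo_pos ρ hpos k σ (2 * Real.pi * w) hσ
    rw [tomo_outer, inv_mul_cancel_left₀ (by positivity)] at this
    exact this
  have hi := tomo_fourier_integrable _ (tomoF_integrable ρ k σ hσ)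
    (tomoF_continuous ρ k σ).continuousAt hn
  have hinv := (tomoF_integrable ρ k σ hσ).fourierInv_fourier_eq hi
    (tomoF_continuous ρ k σ).continuousAt (v := 0)
  have h0 : tomoF ρ k σ 0 = 1 := by simpa [tomoF] using htr
  rw [h0, Real.fourierInv_eq'] at hinv
  simp only [inner_zero_right, mul_zero, Complex.ofReal_zero, zero_mul, Complex.exp_zero,
    one_smul] at hinv
  simp_rw [tomo_outer]
  rw [integral_const_mul, Measure.integral_comp_mul_left (𝓕 (tomoF ρ k σ)), hinv, inv_inv,
    abs_of_pos (by positivity)]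
  have : (Real.pi : ℂ) ≠ 0 := by exact_mod_cast Real.pi_ne_zero
  simp
  field_simp

noncomputable def tomoDiag (ρ : SchwartzMap (ℝ × ℝ) ℂ) : SchwartzMap ℝ ℂ :=
  SchwartzMap.compCLMOfAntilipschitz ℂ (K := 1) (g := fun x : ℝ => (x, x))
    ((ContinuousLinearMap.id ℝ ℝ).prod (ContinuousLinearMap.id ℝ ℝ)).hasTemperateGrowth
    (AntilipschitzWith.of_le_mul_dist fun x y => by simp [Prod.dist_eq]) ρ

lemma tomoDiag_apply (ρ : SchwartzMap (ℝ × ℝ) ℂ) (x : ℝ) : tomoDiag ρ x = ρ (x, x) := rfl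

open scoped FourierTransform in
lemma tomo_zero (ρ : SchwartzMap (ℝ × ℝ) ℂ) (k X : ℝ) (hk : k = 1 ∨ k = -1) :
    ((1 / (2 * Real.pi) : ℝ) : ℂ) * (∫ t : ℝ, ∫ s : ℝ,
      Complex.exp (Complex.I * (s * k - X) * t) * ρ (s - t * 0 / 2, s + t * 0 / 2))
      = ρ (k * X, k * X) := by
  have hkk : k * k = 1 := by rcases hk with rfl | rfl <;> norm_num
  have hka : |k| = 1 := by rcases hk with rfl | rfl <;> norm_num
  have hk0 : k ≠ 0 := by rintro rfl; simp at hkk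
  have hpi : (Real.pi : ℂ) ≠ 0 := by exact_mod_cast Real.pi_ne_zero
  have hkc : (k : ℂ) * k = 1 := by exact_mod_cast hkk
  set d := tomoDiag ρ with hd
  have hi : ∀ t : ℝ, (∫ s : ℝ,
      Complex.exp (Complex.I * (s * k - X) * t) * ρ (s - t * 0 / 2, s + t * 0 / 2)) =
      (fun u : ℝ => Complex.exp (((2 * Real.pi * (u * (k * X)) : ℝ) : ℂ) * Complex.I) •
        𝓕 (d : ℝ → ℂ) u) ((-k / (2 * Real.pi)) * t) := by
    intro t
    simp only
    rw [Real.fourier_real_eq_integral_exp_smul, smul_eq_mul, ← integral_const_mul]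
    congr with s
    rw [smul_eq_mul, ← mul_assoc, ← Complex.exp_add, hd, tomoDiag_apply]
    simp only [mul_zero, zero_div, sub_zero, add_zero]
    congr 2
    push_cast
    field_simp
    linear_combination (X * t) * hkc
  simp_rw [hi]
  rw [Measure.integral_comp_mul_left (fun u : ℝ =>
    Complex.exp (((2 * Real.pi * (u * (k * X)) : ℝ) : ℂ) * Complex.I) • 𝓕 (d : ℝ → ℂ) u)]
  have hinv : 𝓕⁻ (𝓕 (d : ℝ → ℂ)) (k * X) = d (k * X) := by
    refine (d.integrable (μ := volume)).fourierInv_fourier_eq ?_ d.continuous.continuousAt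
    rw [← SchwartzMap.fourier_coe]
    exact (𝓕 d).integrable
  rw [Real.fourierInv_eq'] at hinv
  have hinv2 : ∫ u : ℝ, Complex.exp (((2 * Real.pi * (u * (k * X)) : ℝ) : ℂ) * Complex.I) •
      𝓕 (d : ℝ → ℂ) u = d (k * X) := by
    rw [← hinv]
    congr with u
    simp [mul_comm]
  rw [hinv2, hd, tomoDiag_apply, abs_inv, abs_div, abs_neg, hka, abs_of_pos (by positivity)]
  simp
  field_simp

open Real in
theorem tomogram_probability_density (ρ : SchwartzMap (ℝ × ℝ) ℂ)
    (hpos : ∀ f : SchwartzMap ℝ ℂ, ∃ c : ℝ, 0 ≤ c ∧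
      (∫ x : ℝ, ∫ y : ℝ, (starRingEnd ℂ) (f x) * ρ (x, y) * f y) = c)
    (htr : (∫ x : ℝ, ρ (x, x)) = 1)
    (ω : ℝ → ℝ → ℂ)
    (hω : ∀ X φ : ℝ, ω X φ = (1 / (2 * π) : ℝ) *
      ∫ t : ℝ, ∫ s : ℝ, Complex.exp (Complex.I * (s * Real.cos φ - X) * t) *
        ρ (s - t * Real.sin φ / 2, s + t * Real.sin φ / 2)) :
    ∀ φ : ℝ, (∀ X : ℝ, ∃ c : ℝ, 0 ≤ c ∧ ω X φ = c) ∧ (∫ X : ℝ, ω X φ) = 1 := by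
  intro φ
  simp_rw [← tomo_mem_iff]
  by_cases hσ : Real.sin φ = 0
  · have hk : Real.cos φ = 1 ∨ Real.cos φ = -1 := by
      have := Real.sin_sq_add_cos_sq φ
      rw [hσ] at this
      exact mul_self_eq_one_iff.1 (by nlinarith)
    have hω' : ∀ X, ω X φ = ρ (Real.cos φ * X, Real.cos φ * X) := by
      intro X
      rw [hω, hσ, tomo_zero ρ _ X hk]
    refine ⟨fun X => ?_, ?_⟩
    · rw [hω']; exact tomo_diag ρ hpos _
    · simp_rw [hω']
      rw [Measure.integral_comp_mul_left (fun x => ρ (x, x)), htr]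
      rcases hk with h | h <;> simp [h]
  · refine ⟨fun X => ?_, ?_⟩
    · rw [hω]
      exact tomo_smul (tomo_pos ρ hpos _ _ X hσ) (by positivity)
    · simp_rw [hω]
      exact tomo_total ρ hpos htr _ _ hσ
end
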